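/- Let H₊ and H₋ be finite-dimensional complex inner product spaces and let H = H₊ × H₋ with the product inner product. For linear maps P, Q, S, T : H₊ → H₋, with graphs Γ(P), Γ(Q), Γ(S), Γ(T) in H, the following are equivalent: (i) the pairs (Γ(P), Γ(Q)) and (Γ(S), Γ(T)) are unitarily equivalent, i.e. there exists a unitary operator g : H → H with g(Γ(P)) = Γ(S) and g(Γ(Q)) = Γ(T); (ii) the operator angles DV_{PQ} and DV_{ST} are similar, i.e. there exists an invertible K : H₊ → H₊ with DV_{ST} = K · DV_{PQ} · K⁻¹. (This is the finite-dimensional analogue of the theorem that two pairs of points of the Sato Grassmannian are equivalent under the restricted unitary group iff the classes of their operator angles coincide.) -/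

import Mathlib

/-- The operator angle `DV_{AB} = (Id + A*A)⁻¹ (Id + A*B) (Id + B*B)⁻¹ (Id + B*A)`
between the graphs of `A B : H₊ → H₋` (finite-dimensional complex inner product
spaces). -/
noncomputable def operatorAngle {Hp Hm : Type*}
    [NormedAddCommGroup Hp] [InnerProductSpace ℂ Hp] [FiniteDimensional ℂ Hp]
    [NormedAddCommGroup Hm] [InnerProductSpace ℂ Hm] [FiniteDimensional ℂ Hm]
    (A B : Hp →ₗ[ℂ] Hm) : Hp →ₗ[ℂ] Hp :=
  (Ring.inverse ((1 : Module.End ℂ Hp) + LinearMap.adjoint A ∘ₗ A)) ∘ₗ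
    ((1 : Module.End ℂ Hp) + LinearMap.adjoint A ∘ₗ B) ∘ₗ
      (Ring.inverse ((1 : Module.End ℂ Hp) + LinearMap.adjoint B ∘ₗ B)) ∘ₗ
        ((1 : Module.End ℂ Hp) + LinearMap.adjoint B ∘ₗ A)


section Helpers

/-- Two linear maps with the same norms differ by a unitary on the target. -/
lemma exists_isometry_of_norm_eq {E F : Type*} [AddCommGroup E] [Module ℂ E]
    [NormedAddCommGroup F] [InnerProductSpace ℂ F] [FiniteDimensional ℂ F]
    (f f' : E →ₗ[ℂ] F) (h : ∀ x, ‖f x‖ = ‖f' x‖) :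
    ∃ g : F ≃ₗᵢ[ℂ] F, ∀ x, g (f x) = f' x := by
  have hker : LinearMap.ker f ≤ LinearMap.ker f' := by
    intro x hx
    rw [LinearMap.mem_ker] at hx ⊢
    rw [← norm_eq_zero, ← h, hx, norm_zero]
  let L0 : LinearMap.range f →ₗ[ℂ] F :=
    ((LinearMap.ker f).liftQ f' hker) ∘ₗ (f.quotKerEquivRange.symm : _ →ₗ[ℂ] _)
  have hL0 : ∀ x, L0 ⟨f x, LinearMap.mem_range_self f x⟩ = f' x := by
    intro x
    have : f.quotKerEquivRange.symm ⟨f x, LinearMap.mem_range_self f x⟩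
        = (LinearMap.ker f).mkQ x := f.quotKerEquivRange_symm_apply_image x _
    simp only [L0, LinearMap.comp_apply, LinearEquiv.coe_coe]
    rw [this]
    simp
  let L : LinearMap.range f →ₗᵢ[ℂ] F := ⟨L0, by
    rintro ⟨_, x, rfl⟩
    rw [hL0, ← h]
    rfl⟩
  refine ⟨L.extend.toLinearIsometryEquiv rfl, fun x => ?_⟩
  have := L.extend_apply ⟨f x, LinearMap.mem_range_self f x⟩
  rw [LinearIsometry.coe_toLinearIsometryEquiv]
  exact this.trans (hL0 x)

/-- Symmetric operators with the same characteristic polynomial are unitarily equivalent. -/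
lemma exists_isometry_conj {E : Type*} [NormedAddCommGroup E] [InnerProductSpace ℂ E]
    [FiniteDimensional ℂ E] (A B : E →ₗ[ℂ] E) (hA : A.IsSymmetric) (hB : B.IsSymmetric)
    (h : A.charpoly = B.charpoly) :
    ∃ k : E ≃ₗᵢ[ℂ] E, ∀ x, B (k x) = k (A x) := by
  have he := (hA.eigenvalues_eq_eigenvalues_iff rfl hB rfl).2 h
  let k := (hA.eigenvectorBasis rfl).equiv (hB.eigenvectorBasis rfl) (Equiv.refl _)
  refine ⟨k, fun x => ?_⟩
  have : B ∘ₗ (k : E →ₗ[ℂ] E) = (k : E →ₗ[ℂ] E) ∘ₗ A := by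
    refine (hA.eigenvectorBasis rfl).toBasis.ext fun i => ?_
    have hk : k (hA.eigenvectorBasis rfl i) = hB.eigenvectorBasis rfl i := by simp [k]
    change B (k ((hA.eigenvectorBasis rfl).toBasis i)) = k (A ((hA.eigenvectorBasis rfl).toBasis i))
    rw [OrthonormalBasis.coe_toBasis, hA.apply_eigenvectorBasis, map_smul, hk,
      hB.apply_eigenvectorBasis, he]
  exact LinearMap.congr_fun this x

variable {Hp Hm : Type*}
    [NormedAddCommGroup Hp] [InnerProductSpace ℂ Hp] [FiniteDimensional ℂ Hp]
    [NormedAddCommGroup Hm] [InnerProductSpace ℂ Hm] [FiniteDimensional ℂ Hm]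

lemma exists_param (P : Hp →ₗ[ℂ] Hm) :
    ∃ (U : Hp →ₗᵢ[ℂ] WithLp 2 (Hp × Hm)) (α : Hp ≃ₗ[ℂ] Hp),
      ∀ x, U (α x) = WithLp.toLp 2 (x, P x) := by
  let a : Hp →ₗ[ℂ] WithLp 2 (Hp × Hm) :=
    ((WithLp.linearEquiv 2 ℂ (Hp × Hm)).symm : _ →ₗ[ℂ] _) ∘ₗ (LinearMap.id.prod P)
  have ha : ∀ x, a x = WithLp.toLp 2 (x, P x) := fun x => rfl
  have hinj : Function.Injective a := by
    intro x y hxy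
    rw [ha, ha] at hxy
    have := congrArg (fun z => (WithLp.ofLp z).1) hxy
    simpa using this
  let e := LinearEquiv.ofInjective a hinj
  have hr : Module.finrank ℂ Hp = Module.finrank ℂ (LinearMap.range a) := e.finrank_eq
  let u : Hp ≃ₗᵢ[ℂ] LinearMap.range a :=
    (stdOrthonormalBasis ℂ Hp).equiv (stdOrthonormalBasis ℂ (LinearMap.range a)) (finCongr hr)
  refine ⟨(LinearMap.range a).subtypeₗᵢ.comp u.toLinearIsometry,
    e.trans u.symm.toLinearEquiv, fun x => ?_⟩
  rw [← ha]
  simp [e]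

lemma ring_inverse_factor (α : Hp ≃ₗ[ℂ] Hp) :
    Ring.inverse (LinearMap.adjoint (α : Hp →ₗ[ℂ] Hp) * (α : Module.End ℂ Hp)) =
      ((α.symm : Module.End ℂ Hp) * LinearMap.adjoint (α.symm : Hp →ₗ[ℂ] Hp) :
        Module.End ℂ Hp) := by
  have h1 : (α : Module.End ℂ Hp) * (α.symm : Module.End ℂ Hp) = 1 := by ext; simp
  have h2 : (α.symm : Module.End ℂ Hp) * (α : Module.End ℂ Hp) = 1 := by ext; simp
  have h3 : LinearMap.adjoint (α.symm : Hp →ₗ[ℂ] Hp) * LinearMap.adjoint (α : Hp →ₗ[ℂ] Hp)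
      = (1 : Module.End ℂ Hp) := by
    have := congrArg star h1
    rwa [star_mul, star_one] at this
  have h4 : LinearMap.adjoint (α : Hp →ₗ[ℂ] Hp) * LinearMap.adjoint (α.symm : Hp →ₗ[ℂ] Hp)
      = (1 : Module.End ℂ Hp) := by
    have := congrArg star h2
    rwa [star_mul, star_one] at this
  let w : (Module.End ℂ Hp)ˣ :=
    ⟨LinearMap.adjoint (α : Hp →ₗ[ℂ] Hp) * (α : Module.End ℂ Hp),
      (α.symm : Module.End ℂ Hp) * LinearMap.adjoint (α.symm : Hp →ₗ[ℂ] Hp),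
      by rw [mul_assoc, ← mul_assoc (α : Module.End ℂ Hp), h1, one_mul, h4],
      by rw [mul_assoc, ← mul_assoc (LinearMap.adjoint (α.symm : Hp →ₗ[ℂ] Hp)), h3, one_mul, h2]⟩
  exact Ring.inverse_unit w

lemma one_add_factor (P Q : Hp →ₗ[ℂ] Hm) (U V : Hp →ₗᵢ[ℂ] WithLp 2 (Hp × Hm))
    (α β : Hp ≃ₗ[ℂ] Hp) (N : Module.End ℂ Hp)
    (hU : ∀ x, U (α x) = WithLp.toLp 2 (x, P x)) (hV : ∀ x, V (β x) = WithLp.toLp 2 (x, Q x))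
    (hN : ∀ x y, inner ℂ (U y) (V x) = (inner ℂ y (N x) : ℂ)) :
    (1 : Module.End ℂ Hp) + LinearMap.adjoint P ∘ₗ Q =
      LinearMap.adjoint (α : Hp →ₗ[ℂ] Hp) * (N * (β : Module.End ℂ Hp)) := by
  refine LinearMap.ext fun x => ext_inner_left ℂ fun y => ?_
  have := hN (β x) (α y)
  rw [hU, hV, WithLp.prod_inner_apply] at this
  simp only [LinearMap.add_apply, Module.End.one_apply, LinearMap.comp_apply, inner_add_right,
    LinearMap.adjoint_inner_right, Module.End.mul_apply, LinearEquiv.coe_coe]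
  exact this

lemma operatorAngle_eq (P Q : Hp →ₗ[ℂ] Hm) (U V : Hp →ₗᵢ[ℂ] WithLp 2 (Hp × Hm))
    (α β : Hp ≃ₗ[ℂ] Hp) (M : Module.End ℂ Hp)
    (hU : ∀ x, U (α x) = WithLp.toLp 2 (x, P x)) (hV : ∀ x, V (β x) = WithLp.toLp 2 (x, Q x))
    (hM : ∀ x y, inner ℂ (V y) (U x) = (inner ℂ y (M x) : ℂ)) :
    operatorAngle P Q = (α.symm : Hp →ₗ[ℂ] Hp) ∘ₗ (LinearMap.adjoint M ∘ₗ M) ∘ₗ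
      (α : Hp →ₗ[ℂ] Hp) := by
  have e1 := one_add_factor P P U U α α 1 hU hU (fun x y => by simp)
  have e2 := one_add_factor P Q U V α β (LinearMap.adjoint M) hU hV (fun x y => by
    rw [LinearMap.adjoint_inner_right, ← inner_conj_symm, hM, inner_conj_symm])
  have e3 := one_add_factor Q Q V V β β 1 hV hV (fun x y => by simp)
  have e4 := one_add_factor Q P V U β α M hV hU hM
  rw [one_mul] at e1 e3
  rw [operatorAngle, e1, e2, e3, e4, ring_inverse_factor, ring_inverse_factor]
  have cancel : ∀ (γ : Hp ≃ₗ[ℂ] Hp) (x : Hp), LinearMap.adjoint (γ.symm : Hp →ₗ[ℂ] Hp)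
      (LinearMap.adjoint (γ : Hp →ₗ[ℂ] Hp) x) = x := by
    intro γ x
    refine ext_inner_left ℂ fun y => ?_
    simp [LinearMap.adjoint_inner_right]
  ext x
  simp [cancel]

lemma exists_overlap (U V : Hp →ₗᵢ[ℂ] WithLp 2 (Hp × Hm)) :
    ∃ M : Module.End ℂ Hp, ∀ x y, inner ℂ (V y) (U x) = (inner ℂ y (M x) : ℂ) :=
  ⟨LinearMap.adjoint V.toLinearMap ∘ₗ U.toLinearMap, fun x y => by
    rw [LinearMap.comp_apply, LinearMap.adjoint_inner_right]; rfl⟩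

lemma exists_unitary_of_similar (U V U' V' : Hp →ₗᵢ[ℂ] WithLp 2 (Hp × Hm))
    (M N : Module.End ℂ Hp)
    (hM : ∀ x y, inner ℂ (V y) (U x) = (inner ℂ y (M x) : ℂ))
    (hN : ∀ x y, inner ℂ (V' y) (U' x) = (inner ℂ y (N x) : ℂ))
    (h : LinearMap.charpoly (LinearMap.adjoint M ∘ₗ M) =
      LinearMap.charpoly (LinearMap.adjoint N ∘ₗ N)) :
    ∃ (g : WithLp 2 (Hp × Hm) ≃ₗᵢ[ℂ] WithLp 2 (Hp × Hm)) (k l : Hp ≃ₗᵢ[ℂ] Hp),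
      (∀ x, g (U x) = U' (k x)) ∧ (∀ x, g (V x) = V' (l x)) := by
  have sym : ∀ M : Module.End ℂ Hp, (LinearMap.adjoint M ∘ₗ M).IsSymmetric := fun M x y => by
    simp [LinearMap.adjoint_inner_right, LinearMap.adjoint_inner_left]
  obtain ⟨k, hk⟩ := exists_isometry_conj _ _ (sym M) (sym N) h
  have nrm : ∀ (M : Module.End ℂ Hp) (x : Hp),
      (inner ℂ x (LinearMap.adjoint M (M x)) : ℂ) = ((‖M x‖ ^ 2 : ℝ) : ℂ) := fun M x => by
    rw [LinearMap.adjoint_inner_right, inner_self_eq_norm_sq_to_K]; push_cast; rfl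
  obtain ⟨l, hl⟩ := exists_isometry_of_norm_eq M (N ∘ₗ (k : Hp →ₗ[ℂ] Hp)) (fun x => by
    have h1 := nrm M x
    have h2 := nrm N (k x)
    have h3 := hk x
    simp only [LinearMap.comp_apply] at h3
    rw [h3, k.inner_map_map, h1] at h2
    have h4 : ‖M x‖ ^ 2 = ‖N (k x)‖ ^ 2 := by exact_mod_cast h2
    exact (sq_eq_sq₀ (norm_nonneg _) (norm_nonneg _)).1 h4)
  obtain ⟨g, hg⟩ := exists_isometry_of_norm_eq
    (LinearMap.coprod U.toLinearMap V.toLinearMap)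
    (LinearMap.coprod (U'.toLinearMap ∘ₗ (k : Hp →ₗ[ℂ] Hp))
      (V'.toLinearMap ∘ₗ (l : Hp →ₗ[ℂ] Hp))) (fun ⟨x, y⟩ => by
    have h5 : (inner ℂ (V' (l y)) (U' (k x)) : ℂ) = inner ℂ (V y) (U x) := by
      have h6 : N (k x) = l (M x) := (hl x).symm
      rw [hN, hM, h6, l.inner_map_map]
    have h7 : ‖V y + U x‖ ^ 2 = ‖V' (l y) + U' (k x)‖ ^ 2 := by
      rw [norm_add_sq (𝕜 := ℂ), norm_add_sq (𝕜 := ℂ), h5]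
      simp
    have h8 := (sq_eq_sq₀ (norm_nonneg _) (norm_nonneg _)).1 h7
    simpa [add_comm] using h8)
  refine ⟨g, k, l, fun x => ?_, fun x => ?_⟩
  · simpa using hg (x, 0)
  · simpa using hg (0, x)

lemma map_graph_eq (P S : Hp →ₗ[ℂ] Hm) (U U' : Hp →ₗᵢ[ℂ] WithLp 2 (Hp × Hm))
    (α γ k : Hp ≃ₗ[ℂ] Hp)
    (hU : ∀ x, U (α x) = WithLp.toLp 2 (x, P x)) (hU' : ∀ x, U' (γ x) = WithLp.toLp 2 (x, S x))
    (g : (Hp × Hm) ≃ₗ[ℂ] (Hp × Hm))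
    (hg : ∀ x, WithLp.toLp 2 (g (WithLp.ofLp (U x))) = U' (k x)) :
    Submodule.map (g : (Hp × Hm) →ₗ[ℂ] (Hp × Hm)) (LinearMap.graph P) =
          LinearMap.graph S := by
  have key : ∀ x, g (x, P x) = (γ.symm (k (α x)), S (γ.symm (k (α x)))) := by
    intro x
    have h1 := hg (α x)
    have h2 := hU' (γ.symm (k (α x)))
    rw [LinearEquiv.apply_symm_apply, ← h1, hU] at h2
    exact congrArg WithLp.ofLp h2
  ext ⟨u, v⟩
  simp only [Submodule.mem_map, LinearMap.mem_graph_iff, LinearEquiv.coe_coe]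
  constructor
  · rintro ⟨⟨x, y⟩, hy, h⟩
    simp only at hy
    rw [hy, key] at h
    simp only [Prod.mk.injEq] at h
    rw [← h.2, ← h.1]
  · intro hv
    refine ⟨(α.symm (k.symm (γ u)), P (α.symm (k.symm (γ u)))), rfl, ?_⟩
    rw [key]
    simp [hv]

/-- A linear equivalence mapping graph to graph induces a change of parameter. -/
lemma exists_param_change (P S : Hp →ₗ[ℂ] Hm) (g : (Hp × Hm) ≃ₗ[ℂ] (Hp × Hm))
    (h : Submodule.map (g : (Hp × Hm) →ₗ[ℂ] (Hp × Hm)) (LinearMap.graph P) =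
          LinearMap.graph S) :
    ∃ κ : Hp ≃ₗ[ℂ] Hp, ∀ x, g (κ x, P (κ x)) = (x, S x) := by
  have hmem : ∀ x, (g.symm (x, S x)).2 = P (g.symm (x, S x)).1 := by
    intro x
    have hx : (x, S x) ∈ LinearMap.graph S := by simp [LinearMap.mem_graph_iff]
    rw [← h] at hx
    obtain ⟨z, hz, hzx⟩ := hx
    have : g.symm (x, S x) = z := by rw [← hzx]; simp
    rw [this]
    exact hz
  let f : Hp →ₗ[ℂ] Hp := LinearMap.fst ℂ Hp Hm ∘ₗ (g.symm : (Hp × Hm) →ₗ[ℂ] (Hp × Hm)) ∘ₗ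
    LinearMap.id.prod S
  have hf : ∀ x, g (f x, P (f x)) = (x, S x) := by
    intro x
    have : (f x, P (f x)) = g.symm (x, S x) := Prod.ext rfl (hmem x).symm
    rw [this, g.apply_symm_apply]
  have hinj : Function.Injective f := by
    intro x y hxy
    have h1 := hf x
    rw [hxy, hf y] at h1
    exact (congrArg Prod.fst h1).symm
  exact ⟨LinearEquiv.ofInjectiveEndo f hinj, fun x => by simpa using hf x⟩

end Helpers

/-- Let `P Q S T : H₊ → H₋` be linear maps between finite-dimensional
complex inner product spaces, with graphs in `H = H₊ × H₋` carrying the product inner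
product `⟪(u₁,v₁),(u₂,v₂)⟫ = ⟪u₁,u₂⟫ + ⟪v₁,v₂⟫`.  The pairs `(Γ(P), Γ(Q))` and
`(Γ(S), Γ(T))` are equivalent under a unitary operator of `H` (a linear automorphism
preserving the product inner product) if and only if the operator angles `DV_{PQ}`
and `DV_{ST}` are similar. -/
theorem pairs_unitary_equivalent_iff_operatorAngle_similar
    {Hp Hm : Type*}
    [NormedAddCommGroup Hp] [InnerProductSpace ℂ Hp] [FiniteDimensional ℂ Hp]
    [NormedAddCommGroup Hm] [InnerProductSpace ℂ Hm] [FiniteDimensional ℂ Hm]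
    (P Q S T : Hp →ₗ[ℂ] Hm) :
    (∃ g : (Hp × Hm) ≃ₗ[ℂ] (Hp × Hm),
        (∀ u v : Hp × Hm,
          (inner ℂ (g u).1 (g v).1 : ℂ) + (inner ℂ (g u).2 (g v).2 : ℂ) =
            (inner ℂ u.1 v.1 : ℂ) + (inner ℂ u.2 v.2 : ℂ)) ∧
        Submodule.map (g : (Hp × Hm) →ₗ[ℂ] (Hp × Hm)) (LinearMap.graph P) =
          LinearMap.graph S ∧
        Submodule.map (g : (Hp × Hm) →ₗ[ℂ] (Hp × Hm)) (LinearMap.graph Q) =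
          LinearMap.graph T) ↔
      (∃ K : Hp ≃ₗ[ℂ] Hp,
        operatorAngle S T =
          (K : Hp →ₗ[ℂ] Hp) ∘ₗ operatorAngle P Q ∘ₗ (K.symm : Hp →ₗ[ℂ] Hp)) := by
  obtain ⟨U, α, hU⟩ := exists_param P
  obtain ⟨V, β, hV⟩ := exists_param Q
  obtain ⟨M, hM⟩ := exists_overlap U V
  have hPQ := operatorAngle_eq P Q U V α β M hU hV hM
  constructor
  · rintro ⟨g, hg, hgP, hgQ⟩
    obtain ⟨κ, hκ⟩ := exists_param_change P S g hgP
    obtain ⟨l, hl⟩ := exists_param_change Q T g hgQ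
    let g' : WithLp 2 (Hp × Hm) →ₗᵢ[ℂ] WithLp 2 (Hp × Hm) :=
      LinearMap.isometryOfInner
        (((WithLp.linearEquiv 2 ℂ (Hp × Hm)).symm : _ →ₗ[ℂ] _) ∘ₗ
          (g : (Hp × Hm) →ₗ[ℂ] (Hp × Hm)) ∘ₗ ((WithLp.linearEquiv 2 ℂ (Hp × Hm)) : _ →ₗ[ℂ] _))
        (fun x y => by
          rw [WithLp.prod_inner_apply, WithLp.prod_inner_apply]
          exact hg x.ofLp y.ofLp)
    have hg' : ∀ z, g' z = WithLp.toLp 2 (g z.ofLp) := fun z => rfl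
    have hST := operatorAngle_eq S T (g'.comp U) (g'.comp V) (κ.trans α) (l.trans β) M
      (fun x => by
        change g' (U (α (κ x))) = _
        rw [hU, hg', ← hκ])
      (fun x => by
        change g' (V (β (l x))) = _
        rw [hV, hg', ← hl])
      (fun x y => by
        change inner ℂ (g' (V y)) (g' (U x)) = _
        rw [g'.inner_map_map, hM])
    refine ⟨κ.symm, ?_⟩
    rw [hST, hPQ]
    ext x
    simp
  · rintro ⟨K, hK⟩
    obtain ⟨U', γ, hU'⟩ := exists_param S
    obtain ⟨V', δ, hV'⟩ := exists_param T
    obtain ⟨N, hN⟩ := exists_overlap U' V'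
    have hST := operatorAngle_eq S T U' V' γ δ N hU' hV' hN
    have hch : LinearMap.charpoly (LinearMap.adjoint M ∘ₗ M) =
        LinearMap.charpoly (LinearMap.adjoint N ∘ₗ N) := by
      rw [← LinearEquiv.charpoly_conj ((α.symm.trans K).trans γ) (LinearMap.adjoint M ∘ₗ M)]
      congr 1
      ext x
      have := LinearMap.congr_fun (hST.symm.trans (hK.trans (by rw [hPQ]))) (γ.symm x)
      simp only [LinearMap.comp_apply, LinearEquiv.coe_coe, LinearEquiv.apply_symm_apply] at this
      rw [LinearEquiv.symm_apply_eq] at this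
      simp [LinearEquiv.conj_apply, this]
    obtain ⟨g, k, l, hgU, hgV⟩ := exists_unitary_of_similar U V U' V' M N hM hN hch
    let e := WithLp.linearEquiv 2 ℂ (Hp × Hm)
    refine ⟨(e.symm.trans g.toLinearEquiv).trans e, ?_, ?_, ?_⟩
    · intro u v
      have := g.inner_map_map (WithLp.toLp 2 u) (WithLp.toLp 2 v)
      rw [WithLp.prod_inner_apply, WithLp.prod_inner_apply] at this
      exact this
    · exact map_graph_eq P S U U' α γ k.toLinearEquiv hU hU' _ (fun x => hgU x)
    · exact map_graph_eq Q T V V' β δ l.toLinearEquiv hV hV' _ (fun x => hgV x)
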